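/- A matrix A ∈ M_n(𝕋) is E-dense with respect to the idempotent pseudo units if and only if A is tropically regular; that is, there exists B ∈ M_n(𝕋) such that A ⊙ B and B ⊙ A are idempotent pseudo unit matrices if and only if |A| ∈ ℝ. -/

import Mathlib

/-- The extended tropical semiring `𝕋 = ℝ ∪ {−∞} ∪ ℝ^ν`:
`neginf` is `−∞`, `real a` is the real (tangible) element `a`,
and `ghost a` is the ghost element `a^ν`. -/
inductive T : Type where
  | neginf : T
  | real : ℝ → T
  | ghost : ℝ → T

namespace T

/-- Tropical addition `⊕` on `𝕋`. -/
noncomputable def add : T → T → T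
  | neginf, x => x
  | real a, neginf => real a
  | ghost a, neginf => ghost a
  | real a, real b => if a < b then real b else if b < a then real a else ghost a
  | real a, ghost b => if a ≤ b then ghost b else real a
  | ghost a, real b => if b ≤ a then ghost a else real b
  | ghost a, ghost b => if a < b then ghost b else ghost a

/-- Tropical multiplication `⊙` on `𝕋`. -/
noncomputable def mul : T → T → T
  | neginf, _ => neginf
  | real _, neginf => neginf
  | ghost _, neginf => neginf
  | real a, real b => real (a + b)
  | real a, ghost b => ghost (a + b)
  | ghost a, real b => ghost (a + b)
  | ghost a, ghost b => ghost (a + b)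

/-- The strict order `≺` on `𝕋`. -/
def lt : T → T → Prop
  | neginf, neginf => False
  | neginf, real _ => True
  | neginf, ghost _ => True
  | real _, neginf => False
  | ghost _, neginf => False
  | real a, real b => a < b
  | real a, ghost b => a ≤ b
  | ghost a, real b => a < b
  | ghost a, ghost b => a < b

/-- The order `⪯` on `𝕋`: `x ⪯ y` iff `x = y` or `x ≺ y`. -/
def le (x y : T) : Prop := x = y ∨ lt x y

/-- Membership in `ℝ̄^ν = ℝ^ν ∪ {−∞}` (the ghost elements together with `−∞`). -/
def isGhost : T → Prop
  | neginf => True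
  | real _ => False
  | ghost _ => True

/-- Membership in `ℝ` (the real, tangible elements). -/
def isReal : T → Prop
  | neginf => False
  | real _ => True
  | ghost _ => False

/-- The ghost map `ν : 𝕋 → ℝ̄^ν`. -/
def nu : T → T
  | neginf => neginf
  | real a => ghost a
  | ghost a => ghost a

/-- The projection `π : 𝕋 → ℝ ∪ {−∞}` onto the max-plus semiring `(ℝ ∪ {−∞}, max, +)`,
realized as `WithBot ℝ`. -/
def pi : T → WithBot ℝ
  | neginf => ⊥
  | real a => (a : WithBot ℝ)
  | ghost a => (a : WithBot ℝ)

/-- The embedding `θ : (ℝ ∪ {−∞}, max, +) → 𝕋`, `a ↦ a^ν`, `−∞ ↦ −∞`. -/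
def theta : WithBot ℝ → T :=
  fun x => WithBot.recBotCoe neginf (fun a => ghost a) x

/-- `pow x n` is the `n`-fold tropical product `x ⊙ x ⊙ ⋯ ⊙ x` (with `pow x 0 = 0`, the one). -/
noncomputable def pow (x : T) : ℕ → T
  | 0 => real 0
  | n + 1 => mul x (pow x n)

instance : Std.Commutative add := ⟨by
  intro x y
  cases x <;> cases y <;> simp only [add] <;> split_ifs <;>
    first | rfl | (exfalso; linarith) | (congr 1; linarith)⟩

instance : Std.Associative add := ⟨by
  intro x y z
  cases x <;> cases y <;> cases z <;>
    simp only [add] <;>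
    repeat' (first | split_ifs | simp only [add]) 
  all_goals first | rfl | (exfalso; linarith) | (congr 1; linarith)⟩

instance : Std.Commutative mul := ⟨by
  intro x y
  cases x <;> cases y <;> simp only [mul] <;> congr 1 <;> ring⟩

instance : Std.Associative mul := ⟨by
  intro x y z
  cases x <;> cases y <;> cases z <;> simp only [mul] <;> congr 1 <;> ring⟩

/-- Finite tropical sum `⊕` over a finite index set. -/
noncomputable def sumT {ι : Type*} (s : Finset ι) (f : ι → T) : T := s.fold add neginf f

/-- Finite tropical product `⊙` over a finite index set. -/
noncomputable def prodT {ι : Type*} (s : Finset ι) (f : ι → T) : T := s.fold mul (real 0) f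

/-- Tropical matrix multiplication over `𝕋`. -/
noncomputable def matMul {n : ℕ} (A B : Matrix (Fin n) (Fin n) T) : Matrix (Fin n) (Fin n) T :=
  fun i j => sumT Finset.univ fun k => mul (A i k) (B k j)

/-- The tropical determinant (permanent) `|A| = ⊕_{σ ∈ S_n} a_{1σ(1)} ⊙ ⋯ ⊙ a_{nσ(n)}`. -/
noncomputable def det {n : ℕ} (A : Matrix (Fin n) (Fin n) T) : T :=
  sumT Finset.univ fun σ : Equiv.Perm (Fin n) => prodT Finset.univ fun i => A i (σ i)

/-- `A` is tropically regular if `|A| ∈ ℝ`. -/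
def regular {n : ℕ} (A : Matrix (Fin n) (Fin n) T) : Prop := isReal (det A)

/-- `A` is tropically singular if `|A| ∈ ℝ̄^ν`. -/
def singular {n : ℕ} (A : Matrix (Fin n) (Fin n) T) : Prop := isGhost (det A)

/-- The minor `A_{ij}`: delete row `i` and column `j`. -/
noncomputable def minor {n : ℕ} (A : Matrix (Fin (n+1)) (Fin (n+1)) T) (i j : Fin (n+1)) :
    Matrix (Fin n) (Fin n) T :=
  A.submatrix i.succAbove j.succAbove

/-- The adjoint matrix `Adj(A)`, the transpose of the matrix of minors' determinants. -/
noncomputable def adj {n : ℕ} (A : Matrix (Fin (n+1)) (Fin (n+1)) T) :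
    Matrix (Fin (n+1)) (Fin (n+1)) T :=
  fun i j => det (minor A j i)

/-- The `⊙`-inverse `x^{-1}` (only meaningful away from `−∞`): `a ↦ −a`, `a^ν ↦ (−a)^ν`. -/
def dinv : T → T
  | neginf => neginf
  | real a => real (-a)
  | ghost a => ghost (-a)

/-- The pseudo inverse `A^∇ = Adj(A) ⊙ |A|^{-1}`. -/
noncomputable def pinv {n : ℕ} (A : Matrix (Fin (n+1)) (Fin (n+1)) T) :
    Matrix (Fin (n+1)) (Fin (n+1)) T :=
  fun i j => mul (adj A i j) (dinv (det A))

/-- A pseudo unit matrix: tropically regular, `0` on the diagonal,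
and ghosts (or `−∞`) off the diagonal. -/
def pseudoUnit {n : ℕ} (E : Matrix (Fin n) (Fin n) T) : Prop :=
  regular E ∧ (∀ i, E i i = real 0) ∧ ∀ i j, i ≠ j → isGhost (E i j)

/-- `A` is pseudo invertible if `A ⊙ B` and `B ⊙ A` are pseudo units for some `B`. -/
def pseudoInvertible {n : ℕ} (A : Matrix (Fin n) (Fin n) T) : Prop :=
  ∃ B, pseudoUnit (matMul A B) ∧ pseudoUnit (matMul B A)

/-- The ray/point `P_x ⊆ ℝ ∪ {−∞}` assigned to `x ∈ 𝕋`: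
`P_{−∞} = {−∞}`, `P_a = {a}`, `P_{a^ν} = [−∞, a]`. -/
def P : T → Set (WithBot ℝ)
  | neginf => {⊥}
  | real a => {(a : WithBot ℝ)}
  | ghost a => {t | t ≤ (a : WithBot ℝ)}

end T

namespace T

section Walk

variable {ι : Type*}

/-- The weight of the walk from `a` to `b` whose interior vertices are listed by `l`. -/
noncomputable def walkWeight (w : ι → ι → WithBot ℝ) : ι → List ι → ι → WithBot ℝ
  | a, [], b => w a b
  | a, c :: l, b => w a c + walkWeight w c l b

variable (w : ι → ι → WithBot ℝ)

theorem walkWeight_append (a c b : ι) (x y : List ι) :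
    walkWeight w a (x ++ c :: y) b = walkWeight w a x c + walkWeight w c y b := by
  induction x generalizing a with
  | nil => rfl
  | cons d x ih => simp only [List.cons_append, walkWeight, ih, add_assoc]

theorem walkWeight_eq_sum_zipWith (a b : ι) (l : List ι) :
    walkWeight w a l b = (List.zipWith w (a :: l) (l ++ [b])).sum := by
  induction l generalizing a with
  | nil => simp [walkWeight]
  | cons c l ih => simp [walkWeight, ih]

theorem exists_eq_append_of_not_nodup {l : List ι} (h : ¬ l.Nodup) :
    ∃ a x y z, l = x ++ a :: (y ++ a :: z) := by
  induction l with
  | nil => simp at h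
  | cons b l ih =>
    by_cases hb : b ∈ l
    · obtain ⟨y, z, rfl⟩ := List.append_of_mem hb
      exact ⟨b, [], y, z, rfl⟩
    · obtain ⟨a, x, y, z, rfl⟩ := ih fun hl => h (List.nodup_cons.2 ⟨hb, hl⟩)
      exact ⟨a, b :: x, y, z, rfl⟩

theorem map_formPerm_cons [DecidableEq ι] (a : ι) (l : List ι) (h : (a :: l).Nodup) :
    (a :: l).map (a :: l).formPerm = l ++ [a] := by
  have : l ++ [a] = (a :: l).rotate 1 := by simp
  rw [this]
  apply List.ext_getElem
  · simp
  · intro i h1 h2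
    rw [List.getElem_map, List.formPerm_apply_getElem _ h, List.getElem_rotate]

variable [Fintype ι] [DecidableEq ι]

theorem walkWeight_eq_sum_formPerm (h0 : ∀ i, w i i = 0) (a : ι) (l : List ι)
    (h : (a :: l).Nodup) :
    walkWeight w a l a = ∑ i, w i ((a :: l).formPerm i) := by
  rw [walkWeight_eq_sum_zipWith, ← map_formPerm_cons a l h, List.zipWith_map_right,
    List.zipWith_self, ← List.sum_toFinset _ h]
  apply Finset.sum_subset (Finset.subset_univ _)
  intro i _ hi
  rw [List.formPerm_apply_of_notMem (by simpa using hi), h0]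

variable {w}

theorem closed_walkWeight (h0 : ∀ i, w i i = 0)
    (hw : ∀ σ : Equiv.Perm ι, σ ≠ 1 → ∑ i, w i (σ i) < 0) (a : ι) (l : List ι) :
    walkWeight w a l a ≤ 0 ∧ ((∃ b ∈ l, b ≠ a) → walkWeight w a l a < 0) := by
  induction hm : l.length using Nat.strong_induction_on generalizing a l with
  | _ m ih =>
  subst hm
  by_cases ha : a ∈ l
  · obtain ⟨x, y, rfl⟩ := List.append_of_mem ha
    have hx := ih x.length (by simp) a x rfl
    have hy := ih y.length (by simp; omega) a y rfl
    rw [walkWeight_append]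
    refine ⟨add_nonpos hx.1 hy.1, ?_⟩
    rintro ⟨b, hb, hba⟩
    simp only [List.mem_append, List.mem_cons, hba, false_or] at hb
    rcases hb with hb | hb
    · exact (add_le_of_nonpos_right hy.1).trans_lt (hx.2 ⟨b, hb, hba⟩)
    · exact (add_le_of_nonpos_left hx.1).trans_lt (hy.2 ⟨b, hb, hba⟩)
  · by_cases hl : l.Nodup
    · have hn : (a :: l).Nodup := List.nodup_cons.2 ⟨ha, hl⟩
      rcases l with _ | ⟨b, l⟩
      · simp [walkWeight, h0]
      · have : walkWeight w a (b :: l) a < 0 := by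
          rw [walkWeight_eq_sum_formPerm w h0 a _ hn]
          apply hw
          rw [Ne, List.formPerm_eq_one_iff _ hn]
          simp
        exact ⟨this.le, fun _ => this⟩
    · obtain ⟨c, x, y, z, rfl⟩ := exists_eq_append_of_not_nodup hl
      have hca : c ≠ a := by
        rintro rfl
        simp at ha
      have hy := ih y.length (by simp; omega) c y rfl
      have hxz := ih (x ++ c :: z).length (by simp) a (x ++ c :: z) rfl
      have : walkWeight w a (x ++ c :: (y ++ c :: z)) a < 0 := by
        refine lt_of_le_of_lt ?_ (hxz.2 ⟨c, by simp, hca⟩)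
        rw [walkWeight_append, walkWeight_append, walkWeight_append]
        gcongr
        exact add_le_of_nonpos_left hy.1
      exact ⟨this.le, fun _ => this⟩

theorem exists_nodup_walkWeight_le (h0 : ∀ i, w i i = 0)
    (hw : ∀ σ : Equiv.Perm ι, σ ≠ 1 → ∑ i, w i (σ i) < 0) (a b : ι) (l : List ι) :
    ∃ l' : List ι, l'.Nodup ∧ walkWeight w a l b ≤ walkWeight w a l' b := by
  induction hm : l.length using Nat.strong_induction_on generalizing l with
  | _ m ih =>
  subst hm
  by_cases hl : l.Nodup
  · exact ⟨l, hl, le_rfl⟩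
  · obtain ⟨c, x, y, z, rfl⟩ := exists_eq_append_of_not_nodup hl
    obtain ⟨l', hl', h⟩ := ih (x ++ c :: z).length (by simp) (x ++ c :: z) rfl
    refine ⟨l', hl', le_trans ?_ h⟩
    rw [walkWeight_append, walkWeight_append, walkWeight_append]
    gcongr
    exact add_le_of_nonpos_left (closed_walkWeight h0 hw c y).1

/-- A max-plus matrix with zero diagonal is bounded by a max-plus transitive one (its Kleene star)
as soon as every nontrivial permutation has negative weight. -/
theorem exists_transitive_closure (h0 : ∀ i, w i i = 0)
    (hw : ∀ σ : Equiv.Perm ι, σ ≠ 1 → ∑ i, w i (σ i) < 0) :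
    ∃ s : ι → ι → WithBot ℝ, (∀ i, s i i = 0) ∧ (∀ i j, w i j ≤ s i j) ∧
      (∀ i j k, s i j + s j k ≤ s i k) ∧ ∀ i j, i ≠ j → s i j + s j i < 0 := by
  let s : ι → ι → WithBot ℝ := fun i j =>
    Finset.univ.sup fun l : {l : List ι // l.Nodup} => walkWeight w i l j
  have hle (i j : ι) (l : List ι) : walkWeight w i l j ≤ s i j := by
    obtain ⟨l', hl', h⟩ := exists_nodup_walkWeight_le h0 hw i j l
    exact h.trans (Finset.le_sup (f := fun l : {l : List ι // l.Nodup} => walkWeight w i l j)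
      (Finset.mem_univ ⟨l', hl'⟩))
  have hex (i j : ι) : ∃ l : List ι, s i j = walkWeight w i l j := by
    obtain ⟨l, -, hl⟩ := Finset.exists_mem_eq_sup Finset.univ ⟨⟨[], List.nodup_nil⟩, by simp⟩
      fun l : {l : List ι // l.Nodup} => walkWeight w i l j
    exact ⟨l, hl⟩
  have hws (i j : ι) : w i j ≤ s i j := hle i j []
  refine ⟨s, fun i => ?_, hws, fun i j k => ?_, fun i j hij => ?_⟩
  · obtain ⟨l, hl⟩ := hex i i
    exact le_antisymm (hl ▸ (closed_walkWeight h0 hw i l).1) (h0 i ▸ hws i i)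
  · obtain ⟨x, hx⟩ := hex i j
    obtain ⟨y, hy⟩ := hex j k
    rw [hx, hy, ← walkWeight_append]
    exact hle _ _ _
  · obtain ⟨x, hx⟩ := hex i j
    obtain ⟨y, hy⟩ := hex j i
    rw [hx, hy, ← walkWeight_append]
    exact (closed_walkWeight h0 hw i _).2 ⟨j, by simp, hij.symm⟩

theorem sum_perm_neg {s : ι → ι → WithBot ℝ} (h0 : ∀ i, s i i = 0)
    (ht : ∀ i j k, s i j + s j k ≤ s i k) (hn : ∀ i j, i ≠ j → s i j + s j i < 0)
    {σ : Equiv.Perm ι} (hσ : σ ≠ 1) : ∑ i, s i (σ i) < 0 := by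
  have hiter (i : ι) (N : ℕ) :
      ∑ k ∈ Finset.range N, s ((σ ^ k) i) ((σ ^ (k + 1)) i) ≤ s i ((σ ^ N) i) := by
    induction N with
    | zero => simp [h0]
    | succ N ih =>
      rw [Finset.sum_range_succ]
      exact (add_le_add_left ih _).trans (ht _ _ _)
  obtain ⟨M, hM⟩ : ∃ M, orderOf σ = M + 1 :=
    Nat.exists_eq_succ_of_ne_zero (orderOf_pos σ).ne'
  have hpow : σ ^ (M + 1) = 1 := hM ▸ pow_orderOf_eq_one σ
  have hle (i : ι) : ∑ k ∈ Finset.range (M + 1), s ((σ ^ k) i) ((σ ^ (k + 1)) i) ≤ 0 := by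
    simpa [hpow, h0] using hiter i (M + 1)
  obtain ⟨i₀, hi₀⟩ : ∃ i, σ i ≠ i := by
    by_contra! h
    exact hσ (Equiv.ext h)
  have hlt : ∑ k ∈ Finset.range (M + 1), s ((σ ^ k) i₀) ((σ ^ (k + 1)) i₀) < 0 := by
    rw [Finset.sum_range_succ']
    have h1 := hiter (σ i₀) M
    simp only [← Equiv.Perm.mul_apply, ← pow_succ, hpow] at h1
    refine lt_of_le_of_lt (add_le_add_left h1 _) ?_
    simpa using hn _ _ hi₀
  have htot : ∑ i, ∑ k ∈ Finset.range (M + 1), s ((σ ^ k) i) ((σ ^ (k + 1)) i)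
      = (M + 1) • ∑ i, s i (σ i) := by
    rw [Finset.sum_comm, Finset.sum_congr rfl fun k _ => ?_, Finset.sum_const, Finset.card_range]
    simpa only [pow_succ', Equiv.Perm.mul_apply] using Equiv.sum_comp (σ ^ k) fun i => s i (σ i)
  by_contra! hge
  have h2 : 0 ≤ (M + 1) • ∑ i, s i (σ i) := nsmul_nonneg hge _
  rw [← htot, ← Finset.add_sum_erase _ _ (Finset.mem_univ i₀)] at h2
  exact (((add_le_of_nonpos_right (Finset.sum_nonpos fun i _ => hle i)).trans_lt hlt).not_ge) h2

end Walk

section Semiring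

theorem pi_add (x y : T) : pi (add x y) = max (pi x) (pi y) := by
  cases x <;> cases y <;> simp only [add, pi] <;> (try split_ifs) <;>
    simp_all [le_of_lt]

theorem pi_mul (x y : T) : pi (mul x y) = pi x + pi y := by
  cases x <;> cases y <;> simp [mul, pi]

theorem add_eq_left {x y : T} (h : pi y ≤ pi x) (h' : isGhost x ∨ pi y < pi x) :
    add x y = x := by
  cases x <;> cases y <;> simp_all [add, pi, isGhost]

theorem add_eq_real {x y : T} {r : ℝ} (h : add x y = real r) :
    (x = real r ∧ pi y < r) ∨ (y = real r ∧ pi x < r) := by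
  cases x <;> cases y <;> simp only [add] at h <;> (try split_ifs at h) <;> simp_all [pi]

theorem mul_eq_real {x y : T} {r : ℝ} (h : mul x y = real r) :
    ∃ a b : ℝ, x = real a ∧ y = real b ∧ a + b = r := by
  cases x <;> cases y <;> simp_all [mul]

theorem isGhost_theta (x : WithBot ℝ) : isGhost (theta x) := by
  cases x <;> trivial

theorem pi_theta (x : WithBot ℝ) : pi (theta x) = x := by
  cases x <;> rfl

theorem isGhost_real_mul (r : ℝ) {x : T} (h : isGhost x) : isGhost (mul (real r) x) := by
  cases x <;> trivial

variable {ι : Type*} [DecidableEq ι]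

theorem sumT_insert {s : Finset ι} {i : ι} (hi : i ∉ s) (f : ι → T) :
    sumT (insert i s) f = add (f i) (sumT s f) := Finset.fold_insert hi

theorem prodT_insert {s : Finset ι} {i : ι} (hi : i ∉ s) (f : ι → T) :
    prodT (insert i s) f = mul (f i) (prodT s f) := Finset.fold_insert hi

theorem pi_sumT (s : Finset ι) (f : ι → T) : pi (sumT s f) = s.sup fun i => pi (f i) := by
  induction s using Finset.induction_on with
  | empty => rfl
  | insert i s hi ih => rw [sumT_insert hi, pi_add, ih, Finset.sup_insert]

theorem le_pi_sumT {s : Finset ι} {i : ι} (hi : i ∈ s) (f : ι → T) :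
    pi (f i) ≤ pi (sumT s f) := by
  rw [pi_sumT]
  exact Finset.le_sup (f := fun i => pi (f i)) hi

theorem pi_prodT (s : Finset ι) (f : ι → T) : pi (prodT s f) = ∑ i ∈ s, pi (f i) := by
  induction s using Finset.induction_on with
  | empty => rfl
  | insert i s hi ih => rw [prodT_insert hi, pi_mul, ih, Finset.sum_insert hi]

theorem prodT_real (s : Finset ι) (c : ι → ℝ) :
    prodT s (fun i => real (c i)) = real (∑ i ∈ s, c i) := by
  induction s using Finset.induction_on with
  | empty => rfl
  | insert i s hi ih => rw [prodT_insert hi, ih, Finset.sum_insert hi, mul]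

theorem exists_eq_real_of_prodT_eq_real {s : Finset ι} {f : ι → T} {r : ℝ}
    (h : prodT s f = real r) {i : ι} (hi : i ∈ s) : ∃ a, f i = real a := by
  rw [← Finset.insert_erase hi, prodT_insert (Finset.notMem_erase i s)] at h
  obtain ⟨a, -, ha, -, -⟩ := mul_eq_real h
  exact ⟨a, ha⟩

theorem sumT_eq_of_dominant {s : Finset ι} {f : ι → T} {i : ι} (hi : i ∈ s)
    (hle : ∀ j ∈ s, j ≠ i → pi (f j) ≤ pi (f i))
    (hlt : ∀ j ∈ s, j ≠ i → isGhost (f i) ∨ pi (f j) < pi (f i)) : sumT s f = f i := by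
  rw [← Finset.insert_erase hi, sumT_insert (Finset.notMem_erase i s)]
  rcases (s.erase i).eq_empty_or_nonempty with he | hne
  · rw [he]
    change add (f i) neginf = f i
    cases f i <;> rfl
  · obtain ⟨j, hj, hs⟩ := Finset.exists_mem_eq_sup (s.erase i) hne fun j => pi (f j)
    rw [Finset.mem_erase] at hj
    have hs' : pi (sumT (s.erase i) f) = pi (f j) := (pi_sumT _ _).trans hs
    exact add_eq_left (hs' ▸ hle j hj.2 hj.1) (hs' ▸ hlt j hj.2 hj.1)

theorem exists_dominant_of_sumT_eq_real {s : Finset ι} {f : ι → T} {r : ℝ}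
    (h : sumT s f = real r) :
    ∃ i ∈ s, f i = real r ∧ ∀ j ∈ s, j ≠ i → pi (f j) < r := by
  induction s using Finset.induction_on with
  | empty => exact absurd h (by simp [sumT])
  | insert i s hi ih =>
    rw [sumT_insert hi] at h
    rcases add_eq_real h with ⟨h1, h2⟩ | ⟨h1, h2⟩
    · refine ⟨i, Finset.mem_insert_self i s, h1, fun j hj hji => ?_⟩
      exact (le_pi_sumT (Finset.mem_of_mem_insert_of_ne hj hji) f).trans_lt h2
    · obtain ⟨k, hk, hk1, hk2⟩ := ih h1
      refine ⟨k, Finset.mem_insert_of_mem hk, hk1, fun j hj hjk => ?_⟩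
      rcases Finset.mem_insert.1 hj with rfl | hj
      · exact h2
      · exact hk2 j hj hjk

end Semiring

section Matrix

variable {n : ℕ}

theorem regular_iff_exists_perm (A : Matrix (Fin n) (Fin n) T) :
    regular A ↔ ∃ (σ : Equiv.Perm (Fin n)) (c : Fin n → ℝ), (∀ i, A i (σ i) = real (c i)) ∧
      ∀ τ : Equiv.Perm (Fin n), τ ≠ σ →
        ∑ i, pi (A i (τ i)) < ((∑ i, c i : ℝ) : WithBot ℝ) := by
  constructor
  · intro h
    obtain ⟨r, hr⟩ : ∃ r, det A = real r := by
      unfold regular at h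
      cases hd : det A <;> simp_all [isReal]
    obtain ⟨σ, -, hσ, hlt⟩ := exists_dominant_of_sumT_eq_real hr
    choose c hc using fun i => exists_eq_real_of_prodT_eq_real hσ (Finset.mem_univ i)
    refine ⟨σ, c, hc, fun τ hτ => ?_⟩
    have hsum : ∑ i, c i = r := by
      simpa only [hc, prodT_real, real.injEq] using hσ
    rw [hsum, ← pi_prodT]
    exact hlt τ (Finset.mem_univ τ) hτ
  · rintro ⟨σ, c, hc, hlt⟩
    have hprod : prodT Finset.univ (fun i => A i (σ i)) = real (∑ i, c i) := by
      simp only [hc, prodT_real]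
    have hdom : ∀ τ : Equiv.Perm (Fin n), τ ≠ σ →
        pi (prodT Finset.univ fun i => A i (τ i)) < pi (prodT Finset.univ fun i => A i (σ i)) := by
      intro τ hτ
      rw [hprod, pi_prodT]
      exact hlt τ hτ
    have hdet : det A = prodT Finset.univ fun i => A i (σ i) :=
      sumT_eq_of_dominant (f := fun σ : Equiv.Perm (Fin n) => prodT Finset.univ fun i => A i (σ i))
        (Finset.mem_univ σ) (fun τ _ hτ => (hdom τ hτ).le) fun τ _ hτ => Or.inr (hdom τ hτ)
    rw [regular, hdet, hprod]
    trivial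

theorem pseudoUnit.sum_neg {E : Matrix (Fin n) (Fin n) T} (hE : pseudoUnit E)
    {τ : Equiv.Perm (Fin n)} (hτ : τ ≠ 1) : ∑ i, pi (E i (τ i)) < 0 := by
  obtain ⟨hreg, hdiag, hoff⟩ := hE
  obtain ⟨σ, c, hc, hlt⟩ := (regular_iff_exists_perm E).1 hreg
  have hσ : σ = 1 := by
    ext1 i
    by_contra hi
    have := hoff i (σ i) (Ne.symm hi)
    rw [hc] at this
    exact this
  subst hσ
  have hc0 (i : Fin n) : c i = 0 := by
    simpa [hdiag, eq_comm] using hc i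
  simpa [hc0] using hlt τ hτ

theorem pseudoUnit.add_swap_neg {E : Matrix (Fin n) (Fin n) T} (hE : pseudoUnit E)
    {i j : Fin n} (hij : i ≠ j) : pi (E i j) + pi (E j i) < 0 := by
  have h := hE.sum_neg (τ := Equiv.swap i j) (by simpa using hij)
  rw [← Finset.sum_subset (Finset.subset_univ {i, j}), Finset.sum_pair hij] at h
  · simpa using h
  · intro k _ hk
    simp only [Finset.mem_insert, Finset.mem_singleton, not_or] at hk
    rw [Equiv.swap_apply_of_ne_of_ne hk.1 hk.2, hE.2.1]
    rfl

theorem pi_add_le_pi_matMul (A B : Matrix (Fin n) (Fin n) T) (i k j : Fin n) :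
    pi (A i k) + pi (B k j) ≤ pi (matMul A B i j) := by
  rw [← pi_mul]
  exact le_pi_sumT (Finset.mem_univ k) fun k => mul (A i k) (B k j)

theorem regular_of_pseudoUnit_matMul {A B : Matrix (Fin n) (Fin n) T}
    (h : pseudoUnit (matMul A B)) : regular A := by
  choose f _ hf _ using fun i => exists_dominant_of_sumT_eq_real (h.2.1 i)
  choose c d hc hd hcd using fun i => mul_eq_real (hf i)
  have hinj : Function.Injective f := by
    intro i j hij
    by_contra hne
    have hswap := h.add_swap_neg hne
    have h1 := pi_add_le_pi_matMul A B i (f i) j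
    have h2 := pi_add_le_pi_matMul A B j (f j) i
    rw [hc, hij, hd] at h1
    rw [hc, ← hij, hd] at h2
    have h3 := (add_le_add h1 h2).trans_lt hswap
    simp only [pi] at h3
    norm_cast at h3
    linarith [hcd i, hcd j]
  let σ : Equiv.Perm (Fin n) := Equiv.ofBijective f (Finite.injective_iff_bijective.1 hinj)
  refine (regular_iff_exists_perm A).2 ⟨σ, c, hc, fun τ hτ => ?_⟩
  have hne : σ⁻¹ * τ ≠ 1 := fun h1 => hτ (inv_mul_eq_one.1 h1).symm
  have hle : ∑ i, pi (A i (τ i)) + ∑ i, ((d i : ℝ) : WithBot ℝ) < 0 := by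
    refine lt_of_le_of_lt ?_ (h.sum_neg hne)
    rw [← Equiv.sum_comp (σ⁻¹ * τ) fun i => ((d i : ℝ) : WithBot ℝ), ← Finset.sum_add_distrib]
    refine Finset.sum_le_sum fun i _ => ?_
    have h1 := pi_add_le_pi_matMul A B i (τ i) ((σ⁻¹ * τ) i)
    have h2 : f ((σ⁻¹ * τ) i) = τ i := σ.apply_symm_apply (τ i)
    have h3 := hd ((σ⁻¹ * τ) i)
    rw [h2] at h3
    rw [h3] at h1
    exact h1
  have hsum : ∑ i, d i = -∑ i, c i := by
    rw [← Finset.sum_neg_distrib]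
    exact Finset.sum_congr rfl fun i _ => by linarith [hcd i]
  rw [← WithBot.coe_sum, hsum] at hle
  generalize ∑ i, pi (A i (τ i)) = x at hle
  cases x with
  | bot => exact WithBot.bot_lt_coe _
  | coe x =>
    norm_cast at hle ⊢
    linarith

theorem matMul_apply_eq_of_dominant {A B : Matrix (Fin n) (Fin n) T} {i j : Fin n} (k : Fin n)
    {x : T} (hk : mul (A i k) (B k j) = x) (hle : ∀ m, pi (A i m) + pi (B m j) ≤ pi x)
    (hlt : isGhost x ∨ ∀ m, m ≠ k → pi (A i m) + pi (B m j) < pi x) :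
    matMul A B i j = x := by
  subst hk
  refine sumT_eq_of_dominant (f := fun k => mul (A i k) (B k j)) (Finset.mem_univ k) ?_ ?_
  · exact fun m _ _ => (pi_mul _ _).trans_le (hle m)
  · exact fun m _ hm => hlt.imp_right fun h => (pi_mul _ _).trans_lt (h m hm)

theorem pseudoUnit_and_idempotent {E : Matrix (Fin n) (Fin n) T}
    (hdiag : ∀ i, E i i = real 0) (hoff : ∀ i j, i ≠ j → isGhost (E i j))
    (ht : ∀ i j k, pi (E i j) + pi (E j k) ≤ pi (E i k))
    (hn : ∀ i j, i ≠ j → pi (E i j) + pi (E j i) < 0) :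
    pseudoUnit E ∧ matMul E E = E := by
  have h0 (i : Fin n) : pi (E i i) = 0 := by rw [hdiag]; rfl
  refine ⟨⟨(regular_iff_exists_perm E).2 ⟨1, fun _ => 0, hdiag, fun τ hτ => ?_⟩, hdiag, hoff⟩, ?_⟩
  · simpa using sum_perm_neg (s := fun i j => pi (E i j)) h0 ht hn hτ
  · ext i j
    refine matMul_apply_eq_of_dominant i ?_ (fun m => ht i m j) ?_
    · rw [hdiag]
      cases E i j <;> simp [mul]
    · by_cases hij : i = j
      · subst hij
        exact Or.inr fun m hm => (hn i m hm.symm).trans_eq (h0 i).symm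
      · exact Or.inl (hoff i j hij)

theorem exists_idempotent_of_regular {A : Matrix (Fin n) (Fin n) T} (hA : regular A) :
    ∃ B : Matrix (Fin n) (Fin n) T,
      (pseudoUnit (matMul A B) ∧ matMul (matMul A B) (matMul A B) = matMul A B) ∧
      (pseudoUnit (matMul B A) ∧ matMul (matMul B A) (matMul B A) = matMul B A) := by
  obtain ⟨σ, c, hc, hlt⟩ := (regular_iff_exists_perm A).1 hA
  obtain ⟨s, hs0, hws, hst, hsn⟩ := exists_transitive_closure
    (w := fun i j => pi (A i (σ j)) + ((-c j : ℝ) : WithBot ℝ))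
    (fun i => by simp only [hc, pi]; norm_cast; simp)
    (fun τ hτ => by
      have h := hlt (σ * τ) (by simpa using hτ)
      rw [Finset.sum_add_distrib, Equiv.sum_comp τ fun i => ((-c i : ℝ) : WithBot ℝ),
        ← WithBot.coe_sum, Finset.sum_neg_distrib]
      simp only [Equiv.Perm.mul_apply] at h
      generalize ∑ i, pi (A i (σ (τ i))) = x at h
      cases x with
      | bot => simp
      | coe x =>
        norm_cast at h ⊢
        linarith)
  let S : Matrix (Fin n) (Fin n) T := fun i j => if i = j then real 0 else theta (s i j)
  have hSd (i : Fin n) : S i i = real 0 := if_pos rfl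
  have hSo (i j : Fin n) (hij : i ≠ j) : isGhost (S i j) := by
    simp only [S, if_neg hij, isGhost_theta]
  have hpi (i j : Fin n) : pi (S i j) = s i j := by
    by_cases hij : i = j
    · subst hij
      rw [hSd, hs0]
      rfl
    · simp only [S, if_neg hij, pi_theta]
  let B : Matrix (Fin n) (Fin n) T := fun m j => mul (real (-c (σ.symm m))) (S (σ.symm m) j)
  let F : Matrix (Fin n) (Fin n) T := fun m l =>
    mul (real (c (σ.symm l) - c (σ.symm m))) (S (σ.symm m) (σ.symm l))
  have hAle (i j : Fin n) : pi (A i (σ j)) ≤ s i j + (c j : WithBot ℝ) := by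
    have h := add_le_add_left (hws i j) (c j : WithBot ℝ)
    rwa [add_assoc, ← WithBot.coe_add, neg_add_cancel, WithBot.coe_zero, add_zero] at h
  have hB (k j : Fin n) : B (σ k) j = mul (real (-c k)) (S k j) := by simp [B]
  have hF (k q : Fin n) : F (σ k) (σ q) = mul (real (c q - c k)) (S k q) := by simp [F]
  have hpiF (k q : Fin n) : pi (F (σ k) (σ q)) = ((c q - c k : ℝ) : WithBot ℝ) + s k q := by
    rw [hF, pi_mul, hpi, pi]
  have hAB : matMul A B = S := by
    ext i j
    have hle (k : Fin n) : pi (A i (σ k)) + pi (B (σ k) j) ≤ s i k + s k j := by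
      rw [hB, pi_mul, hpi, ← add_assoc]
      exact add_le_add_left (hws i k) _
    refine matMul_apply_eq_of_dominant (σ i) ?_ (fun m => ?_) ?_
    · rw [hc, hB]
      cases S i j <;> simp [mul]
    · obtain ⟨k, rfl⟩ := σ.surjective m
      rw [hpi]
      exact (hle k).trans (hst i k j)
    · by_cases hij : i = j
      · subst hij
        refine Or.inr fun m hm => ?_
        obtain ⟨k, rfl⟩ := σ.surjective m
        rw [hpi, hs0]
        exact (hle k).trans_lt (hsn i k fun h => hm (h ▸ rfl))
      · exact Or.inl (hSo i j hij)
  have hFd (m : Fin n) : F m m = real 0 := by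
    obtain ⟨k, rfl⟩ := σ.surjective m
    rw [hF, hSd]
    simp [mul]
  have hFo (m l : Fin n) (hml : m ≠ l) : isGhost (F m l) := by
    obtain ⟨k, rfl⟩ := σ.surjective m
    obtain ⟨q, rfl⟩ := σ.surjective l
    rw [hF]
    exact isGhost_real_mul _ (hSo k q fun h => hml (h ▸ rfl))
  have hBA : matMul B A = F := by
    ext m l
    obtain ⟨k, rfl⟩ := σ.surjective m
    obtain ⟨q, rfl⟩ := σ.surjective l
    have hle (j : Fin n) : pi (B (σ k) j) + pi (A j (σ q)) ≤
        ((c q - c k : ℝ) : WithBot ℝ) + (s k j + s j q) := by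
      rw [hB, pi_mul, hpi, sub_eq_neg_add, WithBot.coe_add]
      refine (add_le_add_right (hAle j q) _).trans_eq ?_
      simp only [pi]
      abel
    refine matMul_apply_eq_of_dominant q ?_ (fun j => ?_) ?_
    · rw [hc, hB, hF]
      cases S k q <;> simp only [mul] <;> congr 1 <;> ring
    · rw [hpiF]
      exact (hle j).trans (add_le_add_right (hst k j q) _)
    · by_cases hkq : k = q
      · subst hkq
        refine Or.inr fun j hj => ?_
        rw [hpiF, hs0]
        refine (hle j).trans_lt ?_
        simpa using hsn k j hj.symm
      · exact Or.inl (hFo _ _ fun h => hkq (σ.injective h))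
  refine ⟨B, ?_⟩
  rw [hAB, hBA]
  refine ⟨pseudoUnit_and_idempotent hSd hSo (by simpa only [hpi] using hst)
    (by simpa only [hpi] using hsn), pseudoUnit_and_idempotent hFd hFo ?_ ?_⟩
  · intro m l p
    obtain ⟨i, rfl⟩ := σ.surjective m
    obtain ⟨j, rfl⟩ := σ.surjective l
    obtain ⟨k, rfl⟩ := σ.surjective p
    rw [hpiF, hpiF, hpiF, add_add_add_comm, ← WithBot.coe_add, sub_add_sub_cancel']
    exact add_le_add_right (hst i j k) _
  · intro m l hml
    obtain ⟨i, rfl⟩ := σ.surjective m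
    obtain ⟨j, rfl⟩ := σ.surjective l
    rw [hpiF, hpiF, add_add_add_comm, ← WithBot.coe_add]
    simpa using hsn i j fun h => hml (h ▸ rfl)

end Matrix

end T

/-- `A` is E-dense with respect to the idempotent pseudo units
(there is `B` with `A ⊙ B` and `B ⊙ A` idempotent pseudo unit matrices)
if and only if `A` is tropically regular. -/
theorem edense_iff_regular {n : ℕ} (A : Matrix (Fin n) (Fin n) T) :
    (∃ B : Matrix (Fin n) (Fin n) T,
      (T.pseudoUnit (T.matMul A B) ∧
        T.matMul (T.matMul A B) (T.matMul A B) = T.matMul A B) ∧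
      (T.pseudoUnit (T.matMul B A) ∧
        T.matMul (T.matMul B A) (T.matMul B A) = T.matMul B A)) ↔
    T.regular A :=
  ⟨fun ⟨_, hB, _⟩ => T.regular_of_pseudoUnit_matMul hB.1, T.exists_idempotent_of_regular⟩
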